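/- arXiv:1306.6278 — 10 statements merged into one kernel-verified Lean document; each statement's English description precedes it below -/
import Mathlib

section
/- Let G = (S₁, S₂; W₁, W₂) be a finite two-person game and let (x*, y*) ∈ S₁ × S₂ be a semi-strict Nash equilibrium of G. Then the pair of Dirac mixed strategies (δ_{x*}, δ_{y*}) is a semi-strict Nash equilibrium of the mixed extension Δ(G). -/
/-- A mixed strategy on a finite strategy set `S`. -/
def IsMixed {S : Type} [Fintype S] (ρ : S → ℝ) : Prop :=
  (∀ x, 0 ≤ ρ x) ∧ ∑ x, ρ x = 1

/-- The Dirac mixed strategy concentrated at `x0`. -/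
def dirac {S : Type} [DecidableEq S] (x0 : S) : S → ℝ :=
  fun x => if x = x0 then 1 else 0

/-- Expected payoff in the mixed extension. -/
def expPayoff {S1 S2 : Type} [Fintype S1] [Fintype S2]
    (W : S1 → S2 → ℝ) (ρ1 : S1 → ℝ) (ρ2 : S2 → ℝ) : ℝ :=
  ∑ x, ∑ y, ρ1 x * W x y * ρ2 y

theorem expPayoff_dirac_right {S1 S2 : Type} [Fintype S1] [Fintype S2] [DecidableEq S2]
    (W : S1 → S2 → ℝ) (ρ : S1 → ℝ) (y : S2) :
    expPayoff W ρ (dirac y) = ∑ x, ρ x * W x y := by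
  simp [expPayoff, dirac]

theorem expPayoff_dirac_left {S1 S2 : Type} [Fintype S1] [Fintype S2] [DecidableEq S1]
    (W : S1 → S2 → ℝ) (x : S1) (ρ : S2 → ℝ) :
    expPayoff W (dirac x) ρ = ∑ y, ρ y * W x y := by
  simp [expPayoff, dirac, Finset.sum_ite_irrel, mul_comm]

theorem expPayoff_dirac_dirac {S1 S2 : Type} [Fintype S1] [Fintype S2]
    [DecidableEq S1] [DecidableEq S2] (W : S1 → S2 → ℝ) (x : S1) (y : S2) :
    expPayoff W (dirac x) (dirac y) = W x y := by
  simp [expPayoff_dirac_right, dirac]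

/-- The mean of a function bounded above by `c` is at most `c`. -/
theorem IsMixed.sum_mul_le {S : Type} [Fintype S] {ρ : S → ℝ} (hρ : IsMixed ρ)
    {f : S → ℝ} {c : ℝ} (hf : ∀ x, f x ≤ c) : ∑ x, ρ x * f x ≤ c :=
  calc ∑ x, ρ x * f x ≤ ∑ x, ρ x * c :=
        Finset.sum_le_sum fun x _ => mul_le_mul_of_nonneg_left (hf x) (hρ.1 x)
    _ = c := by rw [← Finset.sum_mul, hρ.2, one_mul]

/-- If the mean of `f ≤ c` equals `c`, then `f = c` on the support, so any `g` that is equal to `d`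
wherever `f = c` has mean `d`. -/
theorem IsMixed.sum_mul_eq {S : Type} [Fintype S] {ρ : S → ℝ} (hρ : IsMixed ρ)
    {f g : S → ℝ} {c d : ℝ} (hf : ∀ x, f x ≤ c) (hfg : ∀ x, f x = c → g x = d)
    (h : ∑ x, ρ x * f x = c) : ∑ x, ρ x * g x = d := by
  have hsum : ∑ x, ρ x * f x = ∑ x, ρ x * c := by
    rw [h, ← Finset.sum_mul, hρ.2, one_mul]
  have hsupp := (Finset.sum_eq_sum_iff_of_le
    fun x _ => mul_le_mul_of_nonneg_left (hf x) (hρ.1 x)).1 hsum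
  calc ∑ x, ρ x * g x = ∑ x, ρ x * d := by
        refine Finset.sum_congr rfl fun x hx => ?_
        rcases mul_eq_mul_left_iff.1 (hsupp x hx) with hc | h0
        · rw [hfg x hc]
        · simp [h0]
    _ = d := by rw [← Finset.sum_mul, hρ.2, one_mul]

/-- A pure semi-strict Nash equilibrium of a finite two-person game is
(via Dirac measures) a semi-strict Nash equilibrium of the mixed extension. -/
theorem pure_SSNE_is_mixed_SSNE {S1 S2 : Type} [Fintype S1] [Fintype S2]
    [DecidableEq S1] [DecidableEq S2] [Nonempty S1] [Nonempty S2]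
    (W1 W2 : S1 → S2 → ℝ) (xs : S1) (ys : S2)
    (hNE1 : ∀ x : S1, W1 x ys ≤ W1 xs ys)
    (hNE2 : ∀ y : S2, W2 xs y ≤ W2 xs ys)
    (hSS1 : ∀ x : S1, W1 x ys = W1 xs ys → W2 x ys = W2 xs ys)
    (hSS2 : ∀ y : S2, W2 xs y = W2 xs ys → W1 xs y = W1 xs ys) :
    ((∀ ρ1 : S1 → ℝ, IsMixed ρ1 →
        expPayoff W1 ρ1 (dirac ys) ≤ expPayoff W1 (dirac xs) (dirac ys)) ∧
     (∀ ρ2 : S2 → ℝ, IsMixed ρ2 →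
        expPayoff W2 (dirac xs) ρ2 ≤ expPayoff W2 (dirac xs) (dirac ys))) ∧
    ((∀ ρ1 : S1 → ℝ, IsMixed ρ1 →
        expPayoff W1 ρ1 (dirac ys) = expPayoff W1 (dirac xs) (dirac ys) →
        expPayoff W2 ρ1 (dirac ys) = expPayoff W2 (dirac xs) (dirac ys)) ∧
     (∀ ρ2 : S2 → ℝ, IsMixed ρ2 →
        expPayoff W2 (dirac xs) ρ2 = expPayoff W2 (dirac xs) (dirac ys) →
        expPayoff W1 (dirac xs) ρ2 = expPayoff W1 (dirac xs) (dirac ys))) := by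
  simp only [expPayoff_dirac_dirac]
  simp only [expPayoff_dirac_right, expPayoff_dirac_left]
  exact ⟨⟨fun _ hρ => hρ.sum_mul_le hNE1, fun _ hρ => hρ.sum_mul_le hNE2⟩,
    fun _ hρ => hρ.sum_mul_eq hNE1 hSS1, fun _ hρ => hρ.sum_mul_eq hNE2 hSS2⟩
end

section
/- Let G = (S₁, S₂; W₁, W₂) be a finite two-person game and let (x*, y*) ∈ S₁ × S₂ be a weakly semi-strict Nash equilibrium of G. Then the pair of Dirac mixed strategies (δ_{x*}, δ_{y*}) is a weakly semi-strict Nash equilibrium of the mixed extension Δ(G). -/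
theorem sum_dirac_mul {S : Type} [Fintype S] [DecidableEq S] (a : S) (f : S → ℝ) :
    ∑ x, dirac a x * f x = f a := by
  simp [dirac]

namespace IsMixed

variable {S : Type} [Fintype S] {ρ : S → ℝ}

theorem sum_mul_const (hρ : IsMixed ρ) (c : ℝ) : ∑ x, ρ x * c = c := by
  rw [← Finset.sum_mul, hρ.2, one_mul]

theorem sum_mul_le_s3 (hρ : IsMixed ρ) {f : S → ℝ} {c : ℝ} (hf : ∀ x, f x ≤ c) :
    ∑ x, ρ x * f x ≤ c :=
  (Finset.sum_le_sum fun x _ => mul_le_mul_of_nonneg_left (hf x) (hρ.1 x)).trans_eq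
    (hρ.sum_mul_const c)

/-- If the mean of `f` attains its upper bound `c`, then `ρ` is supported where `f = c`, so a
lower bound for `g` on that set bounds the mean of `g`. -/
theorem le_sum_mul_of_sum_mul_eq (hρ : IsMixed ρ) {f g : S → ℝ} {c d : ℝ}
    (hf : ∀ x, f x ≤ c) (hg : ∀ x, f x = c → d ≤ g x) (h : ∑ x, ρ x * f x = c) :
    d ≤ ∑ x, ρ x * g x := by
  have hsupp : ∀ x ∈ Finset.univ, ρ x * f x = ρ x * c :=
    (Finset.sum_eq_sum_iff_of_le fun x _ => mul_le_mul_of_nonneg_left (hf x) (hρ.1 x)).1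
      (h.trans (hρ.sum_mul_const c).symm)
  rw [← hρ.sum_mul_const d]
  refine Finset.sum_le_sum fun x hx => ?_
  rcases mul_eq_mul_left_iff.1 (hsupp x hx) with hfx | hzero
  · exact mul_le_mul_of_nonneg_left (hg x hfx) (hρ.1 x)
  · simp [hzero]

end IsMixed

/-- A pure weakly semi-strict Nash equilibrium of a finite two-person game is
(via Dirac measures) a weakly semi-strict Nash equilibrium of the mixed extension. -/
theorem pure_WSSNE_is_mixed_WSSNE {S1 S2 : Type} [Fintype S1] [Fintype S2]
    [DecidableEq S1] [DecidableEq S2] [Nonempty S1] [Nonempty S2]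
    (W1 W2 : S1 → S2 → ℝ) (xs : S1) (ys : S2)
    (hNE1 : ∀ x : S1, W1 x ys ≤ W1 xs ys)
    (hNE2 : ∀ y : S2, W2 xs y ≤ W2 xs ys)
    (hSS1 : ∀ x : S1, W1 x ys = W1 xs ys → W2 x ys ≥ W2 xs ys)
    (hSS2 : ∀ y : S2, W2 xs y = W2 xs ys → W1 xs y ≥ W1 xs ys) :
    ((∀ ρ1 : S1 → ℝ, IsMixed ρ1 →
        expPayoff W1 ρ1 (dirac ys) ≤ expPayoff W1 (dirac xs) (dirac ys)) ∧
     (∀ ρ2 : S2 → ℝ, IsMixed ρ2 →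
        expPayoff W2 (dirac xs) ρ2 ≤ expPayoff W2 (dirac xs) (dirac ys))) ∧
    ((∀ ρ1 : S1 → ℝ, IsMixed ρ1 →
        expPayoff W1 ρ1 (dirac ys) = expPayoff W1 (dirac xs) (dirac ys) →
        expPayoff W2 ρ1 (dirac ys) ≥ expPayoff W2 (dirac xs) (dirac ys)) ∧
     (∀ ρ2 : S2 → ℝ, IsMixed ρ2 →
        expPayoff W2 (dirac xs) ρ2 = expPayoff W2 (dirac xs) (dirac ys) →
        expPayoff W1 (dirac xs) ρ2 ≥ expPayoff W1 (dirac xs) (dirac ys))) := by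
  simp only [expPayoff_dirac_right, expPayoff_dirac_left W1 xs, expPayoff_dirac_left W2 xs,
    sum_dirac_mul]
  exact ⟨⟨fun _ hρ => hρ.sum_mul_le_s3 hNE1, fun _ hρ => hρ.sum_mul_le_s3 hNE2⟩,
    fun _ hρ h => hρ.le_sum_mul_of_sum_mul_eq hNE1 hSS1 h,
    fun _ hρ h => hρ.le_sum_mul_of_sum_mul_eq hNE2 hSS2 h⟩
end

section
/- Let Γ = (Σ₁, Σ₂; P₁, P₂) be a two-person game with payoffs bounded below in the co-player's variable. Then for every (σ₁, σ₂) ∈ Σ₁ × Σ₂ and each i = 1, 2, P♭ᵢ((σ₁, σ₂)) ≤ Pᵢ((σ₁, σ₂)). Moreover, P♭ᵢ((σ₁, σ₂)) = Pᵢ((σ₁, σ₂)) holds for both i = 1 and i = 2 if and only if (σ₁, σ₂) is coupled in wealth improvement (CWI). -/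
/-- Lower payoff of player 1:
`P♭₁(σ₁,σ₂) = inf { P₁(σ₁,τ) : τ, P₂(σ₁,τ) ≥ P₂(σ₁,σ₂) }`. -/
noncomputable def flat1 {X Y : Type} (P1 P2 : X → Y → ℝ) (σ1 : X) (σ2 : Y) : ℝ :=
  sInf {v : ℝ | ∃ τ : Y, P2 σ1 σ2 ≤ P2 σ1 τ ∧ P1 σ1 τ = v}

/-- Lower payoff of player 2:
`P♭₂(σ₁,σ₂) = inf { P₂(τ,σ₂) : τ, P₁(τ,σ₂) ≥ P₁(σ₁,σ₂) }`. -/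
noncomputable def flat2 {X Y : Type} (P1 P2 : X → Y → ℝ) (σ1 : X) (σ2 : Y) : ℝ :=
  sInf {v : ℝ | ∃ τ : X, P1 σ1 σ2 ≤ P1 τ σ2 ∧ P2 τ σ2 = v}

/-- Coupled in wealth improvement. -/
def IsCWI {X Y : Type} (P1 P2 : X → Y → ℝ) (s : X × Y) : Prop :=
  (∀ σ1 : X, P1 σ1 s.2 ≥ P1 s.1 s.2 → P2 σ1 s.2 ≥ P2 s.1 s.2) ∧
  (∀ σ2 : Y, P2 s.1 σ2 ≥ P2 s.1 s.2 → P1 s.1 σ2 ≥ P1 s.1 s.2)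

theorem sInf_image_superlevel_le {Y : Type*} {f g : Y → ℝ} (hf : BddBelow (Set.range f))
    {t τ : Y} (h : g t ≤ g τ) : sInf {v : ℝ | ∃ τ : Y, g t ≤ g τ ∧ f τ = v} ≤ f τ :=
  csInf_le (hf.mono (by rintro _ ⟨τ, -, rfl⟩; exact ⟨τ, rfl⟩)) ⟨τ, h, rfl⟩

theorem sInf_image_superlevel_eq_iff {Y : Type*} {f g : Y → ℝ} (hf : BddBelow (Set.range f))
    (t : Y) : sInf {v : ℝ | ∃ τ : Y, g t ≤ g τ ∧ f τ = v} = f t ↔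
      ∀ τ, g τ ≥ g t → f τ ≥ f t := by
  refine ⟨fun h τ hτ => h ▸ sInf_image_superlevel_le hf hτ, fun h => ?_⟩
  refine (sInf_image_superlevel_le hf le_rfl).antisymm (le_csInf ⟨_, t, le_rfl, rfl⟩ ?_)
  rintro _ ⟨τ, hτ, rfl⟩
  exact h τ hτ

/-- `P♭ᵢ ≤ Pᵢ` everywhere, and equality for both players at a profile holds
exactly at profiles coupled in wealth improvement. -/
theorem flat_le_and_eq_iff_CWI {X Y : Type} [Nonempty X] [Nonempty Y]
    (P1 P2 : X → Y → ℝ)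
    (hB1 : ∀ σ1 : X, BddBelow (Set.range fun σ2 : Y => P1 σ1 σ2))
    (hB2 : ∀ σ2 : Y, BddBelow (Set.range fun σ1 : X => P2 σ1 σ2)) :
    ∀ s : X × Y,
      (flat1 P1 P2 s.1 s.2 ≤ P1 s.1 s.2 ∧ flat2 P1 P2 s.1 s.2 ≤ P2 s.1 s.2) ∧
      ((flat1 P1 P2 s.1 s.2 = P1 s.1 s.2 ∧ flat2 P1 P2 s.1 s.2 = P2 s.1 s.2) ↔
        IsCWI P1 P2 s) := by
  rintro ⟨σ1, σ2⟩
  refine ⟨⟨sInf_image_superlevel_le (g := P2 σ1) (hB1 σ1) le_rfl,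
    sInf_image_superlevel_le (g := fun τ => P1 τ σ2) (hB2 σ2) le_rfl⟩, ?_⟩
  exact (and_congr (sInf_image_superlevel_eq_iff (g := P2 σ1) (hB1 σ1) σ2)
    (sInf_image_superlevel_eq_iff (g := fun τ => P1 τ σ2) (hB2 σ2) σ1)).trans and_comm
end

section
/- Let Σ₁ and Σ₂ be nonempty compact topological spaces and let P₁, P₂ : Σ₁ × Σ₂ → ℝ be continuous. Then the lower payoff functions P♭₁, P♭₂ : Σ₁ × Σ₂ → ℝ are lower semicontinuous. -/
open Topology in
/-- The value function of a parametrized minimization problem with jointly continuous objective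
and constraint over a compact space is lower semicontinuous, if all feasible sets are nonempty. -/
theorem lowerSemicontinuous_sInf_of_constraint {Z T : Type*} [TopologicalSpace Z]
    [TopologicalSpace T] [CompactSpace T] {f g : Z → T → ℝ} {a : Z → ℝ}
    (hf : Continuous fun p : Z × T => f p.1 p.2) (hg : Continuous fun p : Z × T => g p.1 p.2)
    (ha : Continuous a) (hne : ∀ z, ∃ t, a z ≤ g z t) :
    LowerSemicontinuous fun z => sInf {v : ℝ | ∃ t, a z ≤ g z t ∧ f z t = v} := by
  intro z y hy
  obtain ⟨y', hyy', hy'⟩ := exists_between hy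
  have hbdd : BddBelow {v : ℝ | ∃ t, a z ≤ g z t ∧ f z t = v} := by
    have hfz : Continuous (f z) := hf.comp (Continuous.prodMk_right z)
    refine (isCompact_range hfz).bddBelow.mono ?_
    rintro _ ⟨t, -, rfl⟩
    exact ⟨t, rfl⟩
  have hopen : IsOpen {p : Z × T | g p.1 p.2 < a p.1 ∨ y' < f p.1 p.2} :=
    (isOpen_lt hg (ha.comp continuous_fst)).union (isOpen_lt continuous_const hf)
  have hev : ∀ᶠ z' in 𝓝 z, ∀ t ∈ (Set.univ : Set T), g z' t < a z' ∨ y' < f z' t := by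
    refine isCompact_univ.eventually_forall_of_forall_eventually fun t _ => ?_
    refine hopen.mem_nhds (x := (z, t)) ?_
    rcases lt_or_ge (g z t) (a z) with h | h
    · exact Or.inl h
    · exact Or.inr (hy'.trans_le (csInf_le hbdd ⟨t, h, rfl⟩))
  filter_upwards [hev] with z' hz'
  obtain ⟨t₀, ht₀⟩ := hne z'
  refine hyy'.trans_le (le_csInf ⟨_, t₀, ht₀, rfl⟩ ?_)
  rintro _ ⟨t, ht, rfl⟩
  exact ((hz' t trivial).resolve_left ht.not_gt).le

/-- If the strategy spaces are nonempty compact topological spaces and the payoffs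
are continuous, then the lower payoff functions are lower semicontinuous. -/
theorem flat_lowerSemicontinuous {X Y : Type}
    [TopologicalSpace X] [TopologicalSpace Y]
    [CompactSpace X] [CompactSpace Y] [Nonempty X] [Nonempty Y]
    (P1 P2 : X → Y → ℝ)
    (hc1 : Continuous fun p : X × Y => P1 p.1 p.2)
    (hc2 : Continuous fun p : X × Y => P2 p.1 p.2) :
    LowerSemicontinuous (fun p : X × Y => flat1 P1 P2 p.1 p.2) ∧
    LowerSemicontinuous (fun p : X × Y => flat2 P1 P2 p.1 p.2) := by
  constructor
  · exact lowerSemicontinuous_sInf_of_constraint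
      (f := fun (p : X × Y) t => P1 p.1 t) (g := fun (p : X × Y) t => P2 p.1 t)
      (hc1.comp (by fun_prop : Continuous fun q : (X × Y) × Y => (q.1.1, q.2)))
      (hc2.comp (by fun_prop : Continuous fun q : (X × Y) × Y => (q.1.1, q.2)))
      hc2 fun p => ⟨p.2, le_rfl⟩
  · exact lowerSemicontinuous_sInf_of_constraint
      (f := fun (p : X × Y) t => P2 t p.2) (g := fun (p : X × Y) t => P1 t p.2)
      (hc2.comp (by fun_prop : Continuous fun q : (X × Y) × X => (q.2, q.1.2)))
      (hc1.comp (by fun_prop : Continuous fun q : (X × Y) × X => (q.2, q.1.2)))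
      hc1 fun p => ⟨p.1, le_rfl⟩
end

section
/- Let Γ = (Σ₁, Σ₂; P₁, P₂) be a two-person game with payoffs bounded below in the co-player's variable. Then for each i = 1, 2 and every σᵢ ∈ Σᵢ, inf_{σ₋ᵢ ∈ Σ₋ᵢ} Pᵢ((σᵢ, σ₋ᵢ)) = inf_{σ₋ᵢ ∈ Σ₋ᵢ} P♭ᵢ((σᵢ, σ₋ᵢ)). Consequently, the lower value of the game does not change when payoffs are replaced by lower payoffs: sup_{σᵢ ∈ Σᵢ} inf_{σ₋ᵢ ∈ Σ₋ᵢ} Pᵢ((σᵢ, σ₋ᵢ)) = sup_{σᵢ ∈ Σᵢ} inf_{σ₋ᵢ ∈ Σ₋ᵢ} P♭ᵢ((σᵢ, σ₋ᵢ)) (the suprema taken in the extended reals). -/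
/-- Replacing the value of a bounded-below `f` at each point `z` by the infimum of `f` over
`{τ | g z ≤ g τ}` does not change the overall infimum. -/
theorem sInf_range_eq_sInf_range_sInf {Z : Type*} [Nonempty Z] (f g : Z → ℝ)
    (hf : BddBelow (Set.range f)) :
    sInf (Set.range f) =
      sInf (Set.range fun z => sInf {v : ℝ | ∃ τ, g z ≤ g τ ∧ f τ = v}) := by
  have lower (z : Z) : sInf (Set.range f) ≤ sInf {v : ℝ | ∃ τ, g z ≤ g τ ∧ f τ = v} := by
    refine le_csInf ⟨f z, z, le_rfl, rfl⟩ ?_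
    rintro _ ⟨τ, -, rfl⟩
    exact csInf_le hf ⟨τ, rfl⟩
  apply le_antisymm
  · refine le_csInf (Set.range_nonempty _) ?_
    rintro _ ⟨z, rfl⟩
    exact lower z
  · refine le_csInf (Set.range_nonempty _) ?_
    rintro _ ⟨z, rfl⟩
    have hbelow : BddBelow (Set.range fun z => sInf {v : ℝ | ∃ τ, g z ≤ g τ ∧ f τ = v}) := by
      refine ⟨sInf (Set.range f), ?_⟩
      rintro _ ⟨w, rfl⟩
      exact lower w
    have hle : sInf {v : ℝ | ∃ τ, g z ≤ g τ ∧ f τ = v} ≤ f z := by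
      refine csInf_le (hf.mono ?_) ⟨z, le_rfl, rfl⟩
      rintro _ ⟨τ, -, rfl⟩
      exact ⟨τ, rfl⟩
    exact (csInf_le hbelow ⟨z, rfl⟩).trans hle

/-- For each player and each of his strategies, the infimum of the payoff over the
co-player's strategies agrees with that of the lower payoff; consequently the lower
value of the game is unchanged when payoffs are replaced by lower payoffs
(suprema taken in the extended reals). -/
theorem lower_value_invariant {X Y : Type} [Nonempty X] [Nonempty Y]
    (P1 P2 : X → Y → ℝ)
    (hB1 : ∀ σ1 : X, BddBelow (Set.range fun σ2 : Y => P1 σ1 σ2))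
    (hB2 : ∀ σ2 : Y, BddBelow (Set.range fun σ1 : X => P2 σ1 σ2)) :
    (∀ σ1 : X, sInf (Set.range fun σ2 : Y => P1 σ1 σ2) =
        sInf (Set.range fun σ2 : Y => flat1 P1 P2 σ1 σ2)) ∧
    (∀ σ2 : Y, sInf (Set.range fun σ1 : X => P2 σ1 σ2) =
        sInf (Set.range fun σ1 : X => flat2 P1 P2 σ1 σ2)) ∧
    (⨆ σ1 : X, ((sInf (Set.range fun σ2 : Y => P1 σ1 σ2) : ℝ) : EReal)) =
      (⨆ σ1 : X, ((sInf (Set.range fun σ2 : Y => flat1 P1 P2 σ1 σ2) : ℝ) : EReal)) ∧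
    (⨆ σ2 : Y, ((sInf (Set.range fun σ1 : X => P2 σ1 σ2) : ℝ) : EReal)) =
      (⨆ σ2 : Y, ((sInf (Set.range fun σ1 : X => flat2 P1 P2 σ1 σ2) : ℝ) : EReal)) := by
  have h1 (σ1 : X) : sInf (Set.range fun σ2 : Y => P1 σ1 σ2) =
      sInf (Set.range fun σ2 : Y => flat1 P1 P2 σ1 σ2) :=
    sInf_range_eq_sInf_range_sInf (P1 σ1) (P2 σ1) (hB1 σ1)
  have h2 (σ2 : Y) : sInf (Set.range fun σ1 : X => P2 σ1 σ2) =
      sInf (Set.range fun σ1 : X => flat2 P1 P2 σ1 σ2) :=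
    sInf_range_eq_sInf_range_sInf (fun σ1 => P2 σ1 σ2) (fun σ1 => P1 σ1 σ2) (hB2 σ2)
  exact ⟨h1, h2, iSup_congr fun σ1 => by rw [h1 σ1], iSup_congr fun σ2 => by rw [h2 σ2]⟩
end

section
/- Let Γ = (Σ₁, Σ₂; P₁, P₂) be a two-person game with payoffs bounded below in the co-player's variable, and let φ₁, φ₂ : ℝ → ℝ be strictly increasing right-continuous functions. Consider the transformed game Γ̃ = (Σ₁, Σ₂; φ₁∘P₁, φ₂∘P₂). Then the transformed lower payoffs satisfy (φᵢ∘Pᵢ)♭ = φᵢ∘P♭ᵢ for i = 1, 2, and Γ̃ has exactly the same m-equilibria as Γ: ME(Γ̃) = ME(Γ). -/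
/-- Nash equilibrium of the two-person game `(X, Y; P1, P2)`. -/
def IsNE {X Y : Type} (P1 P2 : X → Y → ℝ) (s : X × Y) : Prop :=
  (∀ σ1 : X, P1 σ1 s.2 ≤ P1 s.1 s.2) ∧ (∀ σ2 : Y, P2 s.1 σ2 ≤ P2 s.1 s.2)

/-- A strictly increasing right-continuous function commutes with the constrained infimum of a
family that is bounded below. -/
theorem StrictMono.sInf_constrained_comp {ι : Type} {φ ψ : ℝ → ℝ} (hφ : StrictMono φ)
    (hψ : StrictMono ψ) (hrc : ∀ t : ℝ, ContinuousWithinAt φ (Set.Ici t) t) {f : ι → ℝ}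
    (g : ι → ℝ) (hf : BddBelow (Set.range f)) (i : ι) :
    sInf {v : ℝ | ∃ j : ι, ψ (g i) ≤ ψ (g j) ∧ φ (f j) = v} =
      φ (sInf {v : ℝ | ∃ j : ι, g i ≤ g j ∧ f j = v}) := by
  have hbdd : BddBelow {v : ℝ | ∃ j : ι, g i ≤ g j ∧ f j = v} :=
    hf.mono (by rintro _ ⟨j, -, rfl⟩; exact ⟨j, rfl⟩)
  have hne : {v : ℝ | ∃ j : ι, g i ≤ g j ∧ f j = v}.Nonempty := ⟨f i, i, le_rfl, rfl⟩
  rw [MonotoneOn.map_csInf_of_continuousWithinAt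
    ((hrc _).mono fun v hv => csInf_le hbdd hv) (hφ.monotone.monotoneOn _) hne hbdd]
  congr 1
  ext v
  simp only [hψ.le_iff_le, Set.mem_ofPred_eq, Set.mem_image]
  constructor
  · rintro ⟨j, hj, rfl⟩
    exact ⟨f j, ⟨j, hj, rfl⟩, rfl⟩
  · rintro ⟨_, ⟨j, hj, rfl⟩, rfl⟩
    exact ⟨j, hj, rfl⟩

/-- Transforming the payoffs by strictly increasing right-continuous functions
`φ₁, φ₂ : ℝ → ℝ` transforms the lower payoffs accordingly, `(φᵢ∘Pᵢ)♭ = φᵢ∘P♭ᵢ`,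
and the transformed game has exactly the same m-equilibria (Nash equilibria of the
flat game) as the original game. -/
theorem flat_transform_and_ME_invariant {X Y : Type} [Nonempty X] [Nonempty Y]
    (P1 P2 : X → Y → ℝ) (φ1 φ2 : ℝ → ℝ)
    (hB1 : ∀ σ1 : X, BddBelow (Set.range fun σ2 : Y => P1 σ1 σ2))
    (hB2 : ∀ σ2 : Y, BddBelow (Set.range fun σ1 : X => P2 σ1 σ2))
    (hmono1 : StrictMono φ1) (hmono2 : StrictMono φ2)
    (hrc1 : ∀ t : ℝ, ContinuousWithinAt φ1 (Set.Ici t) t)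
    (hrc2 : ∀ t : ℝ, ContinuousWithinAt φ2 (Set.Ici t) t) :
    (∀ (σ1 : X) (σ2 : Y),
        flat1 (fun a b => φ1 (P1 a b)) (fun a b => φ2 (P2 a b)) σ1 σ2 =
          φ1 (flat1 P1 P2 σ1 σ2)) ∧
    (∀ (σ1 : X) (σ2 : Y),
        flat2 (fun a b => φ1 (P1 a b)) (fun a b => φ2 (P2 a b)) σ1 σ2 =
          φ2 (flat2 P1 P2 σ1 σ2)) ∧
    (∀ s : X × Y,
        IsNE (flat1 (fun a b => φ1 (P1 a b)) (fun a b => φ2 (P2 a b)))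
             (flat2 (fun a b => φ1 (P1 a b)) (fun a b => φ2 (P2 a b))) s ↔
        IsNE (flat1 P1 P2) (flat2 P1 P2) s) := by
  have h1 : ∀ (σ1 : X) (σ2 : Y),
      flat1 (fun a b => φ1 (P1 a b)) (fun a b => φ2 (P2 a b)) σ1 σ2 =
        φ1 (flat1 P1 P2 σ1 σ2) := fun σ1 σ2 =>
    hmono1.sInf_constrained_comp hmono2 hrc1 (P2 σ1) (hB1 σ1) σ2
  have h2 : ∀ (σ1 : X) (σ2 : Y),
      flat2 (fun a b => φ1 (P1 a b)) (fun a b => φ2 (P2 a b)) σ1 σ2 =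
        φ2 (flat2 P1 P2 σ1 σ2) := fun σ1 σ2 =>
    hmono2.sInf_constrained_comp hmono1 hrc2 (fun a => P1 a σ2) (hB2 σ2) σ1
  refine ⟨h1, h2, fun s => ?_⟩
  simp only [IsNE, h1, h2, hmono1.le_iff_le, hmono2.le_iff_le]
end

section
/- Let Γ = (Σ₁, Σ₂; P₁, P₂) be a two-person game with payoffs bounded below in the co-player's variable. If (σ₁*, σ₂*) is a weakly semi-strict Nash equilibrium of Γ, then (σ₁*, σ₂*) is a weakly semi-strict Nash equilibrium of the flat game Γ♭ = (Σ₁, Σ₂; P♭₁, P♭₂). -/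
/-- Weakly semi-strict Nash equilibrium. -/
def IsWSSNE {X Y : Type} (P1 P2 : X → Y → ℝ) (s : X × Y) : Prop :=
  IsNE P1 P2 s ∧
  (∀ σ1 : X, P1 σ1 s.2 = P1 s.1 s.2 → P2 σ1 s.2 ≥ P2 s.1 s.2) ∧
  (∀ σ2 : Y, P2 s.1 σ2 = P2 s.1 s.2 → P1 s.1 σ2 ≥ P1 s.1 s.2)

theorem flat1_le {X Y : Type} {P1 : X → Y → ℝ} (P2 : X → Y → ℝ)
    (hB : ∀ x : X, BddBelow (Set.range fun y : Y => P1 x y)) (x : X) (y : Y) :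
    flat1 P1 P2 x y ≤ P1 x y := by
  refine csInf_le ((hB x).mono ?_) ⟨y, le_rfl, rfl⟩
  rintro _ ⟨τ, -, rfl⟩
  exact ⟨τ, rfl⟩

theorem flat2_le {X Y : Type} (P1 : X → Y → ℝ) {P2 : X → Y → ℝ}
    (hB : ∀ y : Y, BddBelow (Set.range fun x : X => P2 x y)) (x : X) (y : Y) :
    flat2 P1 P2 x y ≤ P2 x y :=
  flat1_le (flip P1) (P1 := flip P2) hB y x

theorem IsWSSNE.le_flat1 {X Y : Type} {P1 P2 : X → Y → ℝ} {s : X × Y}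
    (hs : IsWSSNE P1 P2 s) : P1 s.1 s.2 ≤ flat1 P1 P2 s.1 s.2 := by
  refine le_csInf ⟨_, s.2, le_rfl, rfl⟩ ?_
  rintro _ ⟨τ, hτ, rfl⟩
  exact hs.2.2 τ (le_antisymm (hs.1.2 τ) hτ)

theorem IsWSSNE.le_flat2 {X Y : Type} {P1 P2 : X → Y → ℝ} {s : X × Y}
    (hs : IsWSSNE P1 P2 s) : P2 s.1 s.2 ≤ flat2 P1 P2 s.1 s.2 := by
  refine le_csInf ⟨_, s.1, le_rfl, rfl⟩ ?_
  rintro _ ⟨τ, hτ, rfl⟩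
  exact hs.2.1 τ (le_antisymm (hs.1.1 τ) hτ)

/-- A weakly semi-strict Nash equilibrium of a game is a weakly semi-strict Nash
equilibrium of its flat game. -/
theorem WSSNE_flat {X Y : Type} [Nonempty X] [Nonempty Y]
    (P1 P2 : X → Y → ℝ)
    (hB1 : ∀ σ1 : X, BddBelow (Set.range fun σ2 : Y => P1 σ1 σ2))
    (hB2 : ∀ σ2 : Y, BddBelow (Set.range fun σ1 : X => P2 σ1 σ2))
    (s : X × Y) (hs : IsWSSNE P1 P2 s) :
    IsWSSNE (flat1 P1 P2) (flat2 P1 P2) s := by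
  refine ⟨⟨fun x => ?_, fun y => ?_⟩, fun x hx => ?_, fun y hy => ?_⟩
  · exact (flat1_le P2 hB1 x s.2).trans ((hs.1.1 x).trans hs.le_flat1)
  · exact (flat2_le P1 hB2 s.1 y).trans ((hs.1.2 y).trans hs.le_flat2)
  · have h : P1 x s.2 = P1 s.1 s.2 :=
      le_antisymm (hs.1.1 x) (hs.le_flat1.trans (hx.ge.trans (flat1_le P2 hB1 x s.2)))
    simp only [flat2, h, ge_iff_le, le_refl]
  · have h : P2 s.1 y = P2 s.1 s.2 :=
      le_antisymm (hs.1.2 y) (hs.le_flat2.trans (hy.ge.trans (flat2_le P1 hB2 s.1 y)))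
    simp only [flat1, h, ge_iff_le, le_refl]
end

section
/- Let Γ = (Σ₁, Σ₂; P₁, P₂) be a strictly competitive two-person game whose strategy spaces Σ₁, Σ₂ are nonempty compact metric spaces and whose payoffs P₁, P₂ are continuous. Then the set of Wald solutions of Γ is nonempty, every Wald solution of Γ is an m-equilibrium of Γ, and consequently ME(Γ) ≠ ∅. -/
/-- Wald solution: each player's strategy maximizes his guaranteed (worst-case)
payoff. -/
def IsWald {X Y : Type} (P1 P2 : X → Y → ℝ) (s : X × Y) : Prop :=
  (∀ σ1 : X, sInf (Set.range fun τ : Y => P1 σ1 τ) ≤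
      sInf (Set.range fun τ : Y => P1 s.1 τ)) ∧
  (∀ σ2 : Y, sInf (Set.range fun τ : X => P2 τ σ2) ≤
      sInf (Set.range fun τ : X => P2 τ s.2))

/-- If `g` orders the points of `Y` oppositely to `f`, then constraining `g` from below by its
value at a point does not change the infimum of `f`. -/
theorem sInf_lowerConstrained_eq {Y : Type*} {f g : Y → ℝ} (hf : BddBelow (Set.range f))
    (hfg : ∀ y y', g y ≤ g y' ↔ f y' ≤ f y) (y : Y) :
    sInf {v : ℝ | ∃ τ : Y, g y ≤ g τ ∧ f τ = v} = sInf (Set.range f) := by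
  have hsub : {v : ℝ | ∃ τ : Y, g y ≤ g τ ∧ f τ = v} ⊆ Set.range f := by
    rintro _ ⟨τ, -, rfl⟩
    exact ⟨τ, rfl⟩
  have hbdd := hf.mono hsub
  refine le_antisymm (le_csInf ⟨f y, y, rfl⟩ ?_) (csInf_le_csInf hf ⟨f y, y, le_rfl, rfl⟩ hsub)
  rintro _ ⟨τ, rfl⟩
  rcases le_total (f τ) (f y) with h | h
  · exact csInf_le hbdd ⟨τ, (hfg y τ).2 h, rfl⟩
  · exact (csInf_le hbdd ⟨y, le_rfl, rfl⟩).trans h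

/-- A continuous payoff on a product of compact spaces has a maximin strategy. -/
theorem exists_maximin {X Y : Type*} [TopologicalSpace X] [TopologicalSpace Y]
    [CompactSpace X] [CompactSpace Y] [Nonempty X] (P : X → Y → ℝ)
    (hP : Continuous fun p : X × Y => P p.1 p.2) :
    ∃ x : X, ∀ x' : X, sInf (Set.range fun τ : Y => P x' τ) ≤
      sInf (Set.range fun τ : Y => P x τ) := by
  have hcont : Continuous fun x : X => sInf (Set.range fun τ : Y => P x τ) := by
    simpa only [Set.image_univ] using (isCompact_univ (X := Y)).continuous_sInf hP
  obtain ⟨x, -, hx⟩ := isCompact_univ.exists_isMaxOn Set.univ_nonempty hcont.continuousOn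
  exact ⟨x, fun x' => hx (Set.mem_univ x')⟩

/-- A strictly competitive game with nonempty compact metric strategy spaces and
continuous payoffs has a Wald solution, every Wald solution is an m-equilibrium
(Nash equilibrium of the flat game), and therefore `ME(Γ) ≠ ∅`. -/
theorem competitive_ME_nonempty {X Y : Type}
    [MetricSpace X] [MetricSpace Y]
    [CompactSpace X] [CompactSpace Y] [Nonempty X] [Nonempty Y]
    (P1 P2 : X → Y → ℝ)
    (hc1 : Continuous fun p : X × Y => P1 p.1 p.2)
    (hc2 : Continuous fun p : X × Y => P2 p.1 p.2)
    (hcomp : ∀ s s' : X × Y,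
      P1 s'.1 s'.2 > P1 s.1 s.2 ↔ P2 s'.1 s'.2 < P2 s.1 s.2) :
    (∃ s : X × Y, IsWald P1 P2 s) ∧
    (∀ s : X × Y, IsWald P1 P2 s → IsNE (flat1 P1 P2) (flat2 P1 P2) s) ∧
    (∃ s : X × Y, IsNE (flat1 P1 P2) (flat2 P1 P2) s) := by
  have hiff (s s' : X × Y) : P2 s.1 s.2 ≤ P2 s'.1 s'.2 ↔ P1 s'.1 s'.2 ≤ P1 s.1 s.2 := by
    simpa only [not_lt] using (not_congr (hcomp s s')).symm
  have hflat1 (x : X) (y : Y) : flat1 P1 P2 x y = sInf (Set.range fun τ : Y => P1 x τ) :=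
    sInf_lowerConstrained_eq
      (isCompact_range (hc1.comp (Continuous.prodMk_right x))).bddBelow
      (fun τ τ' => hiff (x, τ) (x, τ')) y
  have hflat2 (x : X) (y : Y) : flat2 P1 P2 x y = sInf (Set.range fun τ : X => P2 τ y) :=
    sInf_lowerConstrained_eq (f := fun τ => P2 τ y) (g := fun τ => P1 τ y)
      (isCompact_range (hc2.comp (Continuous.prodMk_left y))).bddBelow
      (fun τ τ' => (hiff (τ', y) (τ, y)).symm) x
  have hNE (s : X × Y) (hs : IsWald P1 P2 s) : IsNE (flat1 P1 P2) (flat2 P1 P2) s := by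
    simpa only [IsNE, IsWald, hflat1, hflat2] using hs
  obtain ⟨x, hx⟩ := exists_maximin P1 hc1
  obtain ⟨y, hy⟩ := exists_maximin (fun y x => P2 x y) (hc2.comp continuous_swap)
  exact ⟨⟨(x, y), hx, hy⟩, hNE, (x, y), hNE _ ⟨hx, hy⟩⟩
end

section
/- Consider the traveler's dilemma G: the finite two-person game with S₁ = S₂ = {2, 3, …, 100} and payoffs P₁(x, y) = P₂(y, x) = min(x, y) + 2·sign(y − x). Then (2, 2) is the unique Nash equilibrium of G: NE(G) = {(2, 2)}. -/
/-- A strategy in the traveler's dilemma: an integer between 2 and 100. -/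
def TStrat : Type := {n : ℕ // 2 ≤ n ∧ n ≤ 100}

/-- The traveler's dilemma payoff of player 1 (player 2's payoff is
`travPay y x`): `min(x,y) + 2·sign(y − x)`. -/
noncomputable def travPay (x y : TStrat) : ℝ :=
  (min x.1 y.1 : ℝ) + 2 * Real.sign ((y.1 : ℝ) - (x.1 : ℝ))

theorem travPay_of_lt {x y : TStrat} (h : x.1 < y.1) : travPay x y = x.1 + 2 := by
  have h' : (x.1 : ℝ) < y.1 := by exact_mod_cast h
  rw [travPay, min_eq_left h'.le, Real.sign_of_pos (sub_pos.2 h'), mul_one]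

theorem travPay_of_gt {x y : TStrat} (h : y.1 < x.1) : travPay x y = y.1 - 2 := by
  have h' : (y.1 : ℝ) < x.1 := by exact_mod_cast h
  rw [travPay, min_eq_right h'.le, Real.sign_of_neg (sub_neg.2 h')]
  ring

theorem travPay_self (x : TStrat) : travPay x x = x.1 := by
  simp [travPay]

/-- Naming the higher price is never a best response: matching the opponent pays more. -/
theorem le_of_forall_travPay_le {x y : TStrat} (h : ∀ z, travPay z y ≤ travPay x y) :
    x.1 ≤ y.1 := by
  by_contra! hlt
  have := h y
  rw [travPay_self, travPay_of_gt hlt] at this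
  linarith

/-- Matching the opponent is a best response only at the lowest price. -/
theorem eq_two_of_forall_travPay_le {x : TStrat} (h : ∀ z, travPay z x ≤ travPay x x) :
    x.1 = 2 := by
  by_contra hne
  have hx := x.2
  obtain ⟨y, hy⟩ : ∃ y : TStrat, y.1 + 1 = x.1 :=
    ⟨⟨x.1 - 1, by omega, by omega⟩, Nat.sub_add_cancel (by omega)⟩
  have hyx := h y
  rw [travPay_self, travPay_of_lt (by omega), ← hy] at hyx
  push_cast at hyx
  linarith

theorem travPay_le_travPay_two {y : TStrat} (hy : y.1 = 2) (x : TStrat) :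
    travPay x y ≤ travPay y y := by
  rcases (hy.trans_le x.2.1).lt_or_eq with hlt | heq
  · rw [travPay_of_gt hlt, travPay_self]
    linarith
  · rw [Subtype.ext heq]

/-- `(2,2)` is the unique Nash equilibrium of the traveler's dilemma. -/
theorem traveler_NE_unique :
    ∀ s : TStrat × TStrat,
      ((∀ x : TStrat, travPay x s.2 ≤ travPay s.1 s.2) ∧
       (∀ y : TStrat, travPay y s.1 ≤ travPay s.2 s.1)) ↔
      s = (⟨2, by norm_num⟩, ⟨2, by norm_num⟩) := by
  rintro ⟨a, b⟩
  constructor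
  · rintro ⟨h₁, h₂⟩
    obtain rfl : a = b :=
      Subtype.ext (le_antisymm (le_of_forall_travPay_le h₁) (le_of_forall_travPay_le h₂))
    have ha : a = ⟨2, by norm_num⟩ := Subtype.ext (eq_two_of_forall_travPay_le h₁)
    exact Prod.ext ha ha
  · intro h
    obtain ⟨rfl, rfl⟩ := Prod.ext_iff.1 h
    exact ⟨travPay_le_travPay_two rfl, travPay_le_travPay_two rfl⟩
end

section
/- Consider the traveler's dilemma G: the finite two-person game with S₁ = S₂ = {2, 3, …, 100} and payoffs P₁(x, y) = P₂(y, x) = min(x, y) + 2·sign(y − x). Then both (2, 2) and (100, 100) are m-equilibria of G, i.e. both pairs are Nash equilibria of the flat game G♭. -/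
theorem travPay_of_eq {x y : TStrat} (h : x.1 = y.1) : travPay x y = x.1 := by
  simp [travPay, h]

theorem travPay_nonneg (x y : TStrat) : 0 ≤ travPay x y := by
  have hx : (2 : ℝ) ≤ x.1 := by exact_mod_cast x.2.1
  have hy : (2 : ℝ) ≤ y.1 := by exact_mod_cast y.2.1
  rcases lt_trichotomy x.1 y.1 with h | h | h
  · rw [travPay_of_lt h]; linarith
  · rw [travPay_of_eq h]; linarith
  · rw [travPay_of_gt h]; linarith

theorem flat1_travPay_le {x y t : TStrat} (h : travPay y x ≤ travPay t x) :
    flat1 travPay (fun x y => travPay y x) x y ≤ travPay x t :=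
  csInf_le ⟨0, by rintro _ ⟨t, -, rfl⟩; exact travPay_nonneg x t⟩ ⟨t, h, rfl⟩

theorem le_flat1_travPay {x y : TStrat} {c : ℝ}
    (h : ∀ t, travPay y x ≤ travPay t x → c ≤ travPay x t) :
    c ≤ flat1 travPay (fun x y => travPay y x) x y :=
  le_csInf ⟨_, y, le_rfl, rfl⟩ (by rintro _ ⟨t, ht, rfl⟩; exact h t ht)

theorem flat1_travPay_le_of_eq_two (x y : TStrat) (hy : y.1 = 2) :
    flat1 travPay (fun x y => travPay y x) x y ≤ flat1 travPay (fun x y => travPay y x) y y := by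
  have hyr : (y.1 : ℝ) = 2 := by exact_mod_cast hy
  have hlow : 2 ≤ flat1 travPay (fun x y => travPay y x) y y := by
    refine le_flat1_travPay fun t ht => ?_
    rw [travPay_of_eq rfl] at ht
    rcases (show y.1 ≤ t.1 from hy.trans_le t.2.1).lt_or_eq with h | h
    · rw [travPay_of_gt h] at ht; linarith
    · rw [travPay_of_eq h, hyr]
  refine (flat1_travPay_le le_rfl).trans (le_trans ?_ hlow)
  rcases (show y.1 ≤ x.1 from hy.trans_le x.2.1).lt_or_eq with h | h
  · rw [travPay_of_gt h]; linarith
  · rw [travPay_of_eq h.symm, ← h, hyr]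

theorem flat1_travPay_le_of_eq_hundred (x y : TStrat) (hy : y.1 = 100) :
    flat1 travPay (fun x y => travPay y x) x y ≤ flat1 travPay (fun x y => travPay y x) y y := by
  have hyr : (y.1 : ℝ) = 100 := by exact_mod_cast hy
  have hlow : 96 ≤ flat1 travPay (fun x y => travPay y x) y y := by
    refine le_flat1_travPay fun t ht => ?_
    rw [travPay_of_eq rfl] at ht
    rcases (show t.1 ≤ y.1 from t.2.2.trans_eq hy.symm).lt_or_eq with h | h
    · rw [travPay_of_lt h] at ht; rw [travPay_of_gt h]; linarith
    · rw [travPay_of_eq h.symm]; linarith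
  rcases (show x.1 ≤ y.1 from x.2.2.trans_eq hy.symm).lt_or_eq with h | h
  · refine le_trans ?_ hlow
    have hx : (x.1 : ℝ) ≤ 99 := by
      have : x.1 ≤ 99 := by omega
      exact_mod_cast this
    rcases x.2.1.lt_or_eq with h2 | h2
    · let t : TStrat := ⟨x.1 - 1, by omega, by omega⟩
      have ht : t.1 < x.1 := by change x.1 - 1 < x.1; omega
      have htr : (t.1 : ℝ) = x.1 - 1 := by
        change ((x.1 - 1 : ℕ) : ℝ) = _
        rw [Nat.cast_sub (by omega), Nat.cast_one]
      refine (flat1_travPay_le (t := t) ?_).trans ?_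
      · rw [travPay_of_gt h, travPay_of_lt ht]; linarith
      · rw [travPay_of_gt ht]; linarith
    · have hx2 : (x.1 : ℝ) = 2 := by exact_mod_cast h2.symm
      refine (flat1_travPay_le (t := x) ?_).trans ?_
      · rw [travPay_of_gt h, travPay_of_eq rfl]; linarith
      · rw [travPay_of_eq rfl]; linarith
  · rw [show x = y from Subtype.ext h]

/-- Both `(2,2)` and `(100,100)` are m-equilibria of the traveler's dilemma,
i.e. Nash equilibria of its flat game. -/
theorem traveler_ME :
    IsNE (flat1 travPay (fun x y => travPay y x))
         (flat2 travPay (fun x y => travPay y x))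
         (⟨2, by norm_num⟩, ⟨2, by norm_num⟩) ∧
    IsNE (flat1 travPay (fun x y => travPay y x))
         (flat2 travPay (fun x y => travPay y x))
         (⟨100, by norm_num⟩, ⟨100, by norm_num⟩) := by
  exact ⟨⟨fun x => flat1_travPay_le_of_eq_two x _ rfl, fun x => flat1_travPay_le_of_eq_two x _ rfl⟩,
    fun x => flat1_travPay_le_of_eq_hundred x _ rfl,
    fun x => flat1_travPay_le_of_eq_hundred x _ rfl⟩
end
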